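/- Let M be a matching in a simple graph G with |M| < ν(G), where ν(G) is the maximum matching size. Then there exists an M-augmenting path in G. -/

import Mathlib

/-- `M` is a matching of `G`: a set of edges of `G` that are pairwise vertex-disjoint. -/
def IsMatch {V : Type*} (G : SimpleGraph V) (M : Set (Sym2 V)) : Prop :=
  M ⊆ G.edgeSet ∧ ∀ e ∈ M, ∀ f ∈ M, e ≠ f → ∀ v : V, ¬(v ∈ e ∧ v ∈ f)

/-- The set of endpoints of edges of `M`. -/
def matchVerts {V : Type*} (M : Set (Sym2 V)) : Set V := {v | ∃ e ∈ M, v ∈ e}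

/-- `P` is an `M`-augmenting path: a path whose endpoints are unmatched by `M`, of odd
length, whose edges alternate between `E(G) \ M` and `M`, starting and ending with
edges not in `M`. -/
def IsAugPath {V : Type*} (G : SimpleGraph V) (M : Set (Sym2 V)) {s t : V}
    (P : G.Walk s t) : Prop :=
  P.IsPath ∧ s ∉ matchVerts M ∧ t ∉ matchVerts M ∧ Odd P.length ∧
    ∀ (i : ℕ) (h : i < P.edges.length), (P.edges.get ⟨i, h⟩ ∈ M ↔ i % 2 = 1)

theorem exists_walk_seq {V : Type*} (G : SimpleGraph V) (w : ℕ → V) (L : ℕ)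
    (h : ∀ i < L, G.Adj (w i) (w (i + 1))) :
    ∃ P : G.Walk (w 0) (w L), P.length = L ∧ P.support = (List.range (L + 1)).map w ∧
      P.edges = (List.range L).map (fun i => s(w i, w (i + 1))) := by
  induction L with
  | zero => exact ⟨SimpleGraph.Walk.nil, by simp⟩
  | succ k ih =>
    obtain ⟨P, h1, h2, h3⟩ := ih (fun i hi => h i (by omega))
    refine ⟨P.concat (h k (by omega)), ?_, ?_, ?_⟩
    · simp [h1]
    · rw [SimpleGraph.Walk.support_concat, h2, List.range_succ (n := k + 1)]
      simp
    · rw [SimpleGraph.Walk.edges_concat, h3, List.range_succ (n := k)]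
      simp

theorem IsMatch.exists_invol {V : Type*} {G : SimpleGraph V} {M : Set (Sym2 V)}
    (hM : IsMatch G M) : ∃ m : V → V, (∀ x, m (m x) = x) ∧
      (∀ x y, s(x, y) ∈ M → m x = y) ∧ (∀ x, m x ≠ x → s(x, m x) ∈ M) ∧
      (∀ x, x ∈ matchVerts M ↔ m x ≠ x) := by
  classical
  have key : ∀ x y z, s(x, y) ∈ M → s(x, z) ∈ M → y = z := by
    intro x y z h1 h2
    by_contra hne
    exact hM.2 _ h1 _ h2 (fun h => hne (Sym2.congr_right.mp h)) x (by simp)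
  let m : V → V := fun x => if h : ∃ y, s(x, y) ∈ M then h.choose else x
  have hm1 : ∀ x y, s(x, y) ∈ M → m x = y := by
    intro x y h
    have hex : ∃ y, s(x, y) ∈ M := ⟨y, h⟩
    have : m x = hex.choose := dif_pos hex
    rw [this]
    exact key x _ _ hex.choose_spec h
  have hm2 : ∀ x, (¬ ∃ y, s(x, y) ∈ M) → m x = x := fun x h => dif_neg h
  refine ⟨m, ?_, hm1, ?_, ?_⟩
  · intro x
    by_cases h : ∃ y, s(x, y) ∈ M
    · obtain ⟨y, hy⟩ := h
      rw [hm1 x y hy]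
      exact hm1 y x (by rwa [Sym2.eq_swap])
    · rw [hm2 x h, hm2 x h]
  · intro x hx
    by_cases h : ∃ y, s(x, y) ∈ M
    · obtain ⟨y, hy⟩ := h
      rwa [hm1 x y hy]
    · exact absurd (hm2 x h) hx
  · intro x
    constructor
    · rintro ⟨e, he, hxe⟩
      obtain ⟨y, rfl⟩ := Sym2.mem_iff_exists.mp hxe
      rw [hm1 x y he]
      exact (G.ne_of_adj (hM.1 he)).symm
    · intro hx
      by_cases h : ∃ y, s(x, y) ∈ M
      · obtain ⟨y, hy⟩ := h
        exact ⟨_, hy, by simp⟩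
      · exact absurd (hm2 x h) hx

theorem IsMatch.ncard_verts {V : Type*} [Fintype V] {G : SimpleGraph V} {M : Set (Sym2 V)}
    (hM : IsMatch G M) : (matchVerts M).ncard = 2 * M.ncard := by
  classical
  have hfin : M.Finite := Set.toFinite M
  have e1 : matchVerts M = ((hfin.toFinset.biUnion (fun e => e.toFinset) : Finset V) : Set V) := by
    ext x
    simp [matchVerts]
  rw [e1, Set.ncard_coe_finset, Finset.card_biUnion, Set.ncard_eq_toFinset_card M hfin]
  · rw [Finset.sum_const_nat (m := 2)]
    · ring
    · intro e he
      apply Sym2.card_toFinset_of_not_isDiag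
      exact G.not_isDiag_of_mem_edgeSet (hM.1 (by simpa using he))
  · intro e he f hf hne
    rw [Function.onFun, Finset.disjoint_left]
    intro v hv hv'
    exact hM.2 e (by simpa using he) f (by simpa using hf) hne v
      ⟨by simpa using hv, by simpa using hv'⟩

theorem refl_orbit {V : Type*} (m n : V → V) (hm : ∀ x, m (m x) = x) (hn : ∀ x, n (n x) = x)
    (s : V) (hs : m s = s) (p : ℕ) (hp : (m ∘ n)^[p] s = s) :
    (∀ j ≤ p, m ((m ∘ n)^[j] s) = (m ∘ n)^[p - j] s) ∧
    (∀ j < p, n ((m ∘ n)^[j] s) = (m ∘ n)^[p - 1 - j] s) := by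
  have h1 : ∀ j ≤ p, m ((m ∘ n)^[j] s) = (m ∘ n)^[p - j] s := by
    intro j
    induction j with
    | zero => intro _; simp [hs, hp]
    | succ k ih =>
      intro hk
      have := ih (by omega)
      rw [show p - k = (p - (k + 1)) + 1 by omega, Function.iterate_succ_apply'] at this
      rw [Function.iterate_succ_apply']
      simp only [Function.comp_apply] at this ⊢
      rw [hm]
      have h2 := congrArg m this
      rw [hm, hm] at h2
      have h3 := congrArg n h2
      rw [hn] at h3
      exact h3
  refine ⟨h1, fun j hj => ?_⟩
  have := h1 (j + 1) (by omega)
  rw [Function.iterate_succ_apply'] at this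
  simp only [Function.comp_apply] at this
  rw [hm] at this
  rw [show p - 1 - j = p - (j + 1) by omega]
  exact this

theorem stmt_17 {V : Type*} [Fintype V] (G : SimpleGraph V) (M N : Set (Sym2 V))
    (hM : IsMatch G M) (hN : IsMatch G N) (hlt : M.ncard < N.ncard) :
    ∃ (s t : V) (P : G.Walk s t), IsAugPath G M P := by
  classical
  obtain ⟨m, hm, hm1, hm2, hm3⟩ := hM.exists_invol
  obtain ⟨n, hn, hn1, hn2, hn3⟩ := hN.exists_invol
  have hσinj : Function.Injective (m ∘ n) :=
    (Function.Involutive.injective hm).comp (Function.Involutive.injective hn)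
  have hper : ∀ x, x ∈ Function.periodicPts (m ∘ n) := hσinj.mem_periodicPts
  by_cases hodd : ∀ s, m s = s → Odd (Function.minimalPeriod (m ∘ n) s)
  · exfalso
    have hle : ((matchVerts M)ᶜ).ncard ≤ ((matchVerts N)ᶜ).ncard := by
      apply Set.ncard_le_ncard_of_injOn
        (fun s => (m ∘ n)^[(Function.minimalPeriod (m ∘ n) s - 1) / 2] s)
      · intro s hs
        have hs' : m s = s := by
          by_contra h
          exact hs ((hm3 s).2 h)
        obtain ⟨k, hk⟩ := hodd s hs'
        have h := (refl_orbit m n hm hn s hs' _ (Function.iterate_minimalPeriod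
          (f := m ∘ n) (x := s))).2 k (by omega)
        intro hc
        rw [hn3] at hc
        apply hc
        rw [show (Function.minimalPeriod (m ∘ n) s - 1) / 2 = k by omega, h]
        congr 1
        rw [hk]
        congr 1
        omega
      · intro s hs s' hs' heq
        simp only at heq
        have hp := congrArg (Function.minimalPeriod (m ∘ n)) heq
        rw [Function.minimalPeriod_apply_iterate (hper s),
          Function.minimalPeriod_apply_iterate (hper s')] at hp
        rw [hp] at heq
        exact hσinj.iterate _ heq
    have e1 := Set.ncard_add_ncard_compl (matchVerts M)
    have e2 := Set.ncard_add_ncard_compl (matchVerts N)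
    rw [hM.ncard_verts] at e1
    rw [hN.ncard_verts] at e2
    omega
  · push Not at hodd
    obtain ⟨s, hs, hev⟩ := hodd
    rw [Nat.not_odd_iff_even] at hev
    obtain ⟨q, hq⟩ := hev
    have hp0 : 0 < Function.minimalPeriod (m ∘ n) s :=
      Function.minimalPeriod_pos_of_mem_periodicPts (hper s)
    obtain ⟨hA, hB⟩ := refl_orbit m n hm hn s hs _ (Function.iterate_minimalPeriod
          (f := m ∘ n) (x := s))
    have hinj : ∀ i j, i < q + q → j < q + q → (m ∘ n)^[i] s = (m ∘ n)^[j] s → i = j := by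
      intro i j hi hj h
      exact (Function.iterate_eq_iterate_iff_of_lt_minimalPeriod
        (by omega) (by omega)).1 h
    have hper' : ∀ i, Function.minimalPeriod (m ∘ n) ((m ∘ n)^[i] s) = q + q := by
      intro i
      rw [Function.minimalPeriod_apply_iterate (hper s), hq]
    rw [hq] at hA hB hp0
    let g : ℕ → ℕ := fun i => if i % 2 = 0 then i / 2 else q + q - 1 - i / 2
    have hg : ∀ i < q + q, g i < q + q := by
      intro i hi
      simp only [g]; split_ifs <;> omega
    have hginj : ∀ i j, i < q + q → j < q + q → g i = g j → i = j := by
      intro i j hi hj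
      simp only [g]; split_ifs <;> omega
    let w : ℕ → V := fun i => (m ∘ n)^[g i] s
    have hwinj : ∀ i j, i < q + q → j < q + q → w i = w j → i = j := fun i j hi hj h =>
      hginj i j hi hj (hinj _ _ (hg i hi) (hg j hj) h)
    have hev : ∀ i < q + q, i % 2 = 0 → n (w i) = w (i + 1) := by
      intro i hi h
      have e1 : g i = i / 2 := if_pos h
      have e2 : g (i + 1) = q + q - 1 - i / 2 := by
        simp only [g]; rw [if_neg (by omega)]; omega
      simp only [w]
      rw [e1, e2]
      exact hB _ (by omega)
    have hod : ∀ i < q + q, i % 2 = 1 → m (w i) = w (i + 1) := by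
      intro i hi h
      have e1 : g i = q + q - 1 - i / 2 := if_neg (by omega)
      have e2 : g (i + 1) = q + q - (q + q - 1 - i / 2) := by
        simp only [g]; rw [if_pos (by omega)]; omega
      simp only [w]
      rw [e1, e2]
      exact hA _ (by omega)
    have hne : ∀ i, i + 1 < q + q → w (i + 1) ≠ w i := by
      intro i hi h
      have := hwinj _ _ hi (by omega) h
      omega
    have hedge : ∀ i, i + 1 < q + q → i % 2 = 1 → s(w i, w (i + 1)) ∈ M := by
      intro i hi h
      rw [← hod i (by omega) h]
      apply hm2
      rw [hod i (by omega) h]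
      exact hne i hi
    have hedge' : ∀ i, i + 1 < q + q → i % 2 = 0 → s(w i, w (i + 1)) ∈ N := by
      intro i hi h
      rw [← hev i (by omega) h]
      apply hn2
      rw [hev i (by omega) h]
      exact hne i hi
    obtain ⟨P, h1, h2, h3⟩ := exists_walk_seq G w (q + q - 1) (by
      intro i hi
      rcases Nat.mod_two_eq_zero_or_one i with h | h
      · exact hN.1 (hedge' i (by omega) h)
      · exact hM.1 (hedge i (by omega) h))
    refine ⟨_, _, P, ?_, ?_, ?_, ?_, ?_⟩
    · rw [SimpleGraph.Walk.isPath_def, h2]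
      apply List.Nodup.map_on _ List.nodup_range
      intro i hi j hj
      rw [List.mem_range] at hi hj
      exact hwinj i j (by omega) (by omega)
    · rw [hm3, not_not]
      exact hs
    · rw [hm3, not_not]
      have e1 : g (q + q - 1) = q := by
        simp only [g]; rw [if_neg (by omega)]; omega
      simp only [w]
      rw [e1, hA q (by omega), Nat.add_sub_cancel]
    · rw [h1]
      exact ⟨q - 1, by omega⟩
    · intro i hi
      have hi' : i < q + q - 1 := by simpa [h3] using hi
      have e : P.edges.get ⟨i, hi⟩ = s(w i, w (i + 1)) := by
        simp [h3]
      rw [e]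
      refine ⟨fun h => ?_, hedge i (by omega)⟩
      by_contra hc
      have h4 := hev i (by omega) (by omega)
      have h5 := hm1 _ _ h
      have h6 : Function.minimalPeriod (m ∘ n) (w i) = 1 := by
        rw [Function.minimalPeriod_eq_one_iff_isFixedPt]
        show m (n (w i)) = w i
        rw [h4, ← h5, hm]
      have h7 : Function.minimalPeriod (m ∘ n) (w i) = q + q := hper' _
      omega
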